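/- arXiv:2603.18965 — 9 statements merged into one kernel-verified Lean document; each statement's English description precedes it below -/
import Mathlib

section
/- Suppose that ν, q*, every κ(x) (for x ∈ X), and the mixture ν.bind κ are mutually absolutely continuous with strictly positive densities and bounded log-density ratios, and let L ≥ 0 be a real constant such that |log(dν/dq*)| ≤ L holds everywhere. Then ∫_X (−KL(κ(x) ‖ q*)) dν(x) ≤ −KL(ν ‖ q*) + L·√(2·KL(ν ‖ ν.bind κ)); equivalently, ∫_X KL(κ(x) ‖ q*) dν(x) ≥ KL(ν ‖ q*) − L·√(2·KL(ν ‖ ν.bind κ)). -/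
open MeasureTheory ProbabilityTheory

/-- Real-valued Kullback–Leibler divergence `∫ log (dμ/dρ) dμ`. -/
noncomputable def klReal {X : Type*} [MeasurableSpace X] (μ ρ : Measure X) : ℝ :=
  ∫ x, llr μ ρ x ∂μ

/-- The Donsker–Varadhan inequality: `∫ f dμ ≤ KL(μ ‖ ρ) + log ∫ exp f dρ`. -/
theorem integral_le_klReal_add_log_integral_exp {X : Type*} [MeasurableSpace X]
    {μ ρ : Measure X} [IsProbabilityMeasure μ] [IsProbabilityMeasure ρ] {f : X → ℝ}
    (hμρ : μ ≪ ρ) (hfμ : Integrable f μ) (hfρ : Integrable (fun x => Real.exp (f x)) ρ)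
    (h_int : Integrable (llr μ ρ) μ) :
    ∫ x, f x ∂μ ≤ klReal μ ρ + Real.log (∫ x, Real.exp (f x) ∂ρ) := by
  have : IsProbabilityMeasure (ρ.tilted f) := isProbabilityMeasure_tilted hfρ
  have hgibbs := InformationTheory.integral_llr_add_sub_measure_univ_nonneg
    (hμρ.trans (absolutelyContinuous_tilted hfρ))
    (integrable_llr_tilted_right hμρ hfμ h_int hfρ)
  rw [integral_llr_tilted_right hμρ hfμ hfρ h_int] at hgibbs
  simp only [probReal_univ] at hgibbs
  unfold klReal
  linarith

/-- A bounded-test-function form of Pinsker's inequality. -/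
theorem integral_sub_integral_le_mul_sqrt_klReal {X : Type*} [MeasurableSpace X]
    {μ ρ : Measure X} [IsProbabilityMeasure μ] [IsProbabilityMeasure ρ] {f : X → ℝ} {L : ℝ}
    (hμρ : μ ≪ ρ) (h_int : Integrable (llr μ ρ) μ) (hf : Measurable f) (hL : 0 ≤ L)
    (hfL : ∀ x, |f x| ≤ L) :
    ∫ x, f x ∂μ - ∫ x, f x ∂ρ ≤ L * Real.sqrt (2 * klReal μ ρ) := by
  have hfμ : Integrable f μ :=
    .of_bound hf.aestronglyMeasurable L (.of_forall hfL)
  have hsub := hasSubgaussianMGF_of_mem_Icc (μ := ρ) (X := f) (a := -L) (b := L)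
    hf.aemeasurable (.of_forall fun x => abs_le.mp (hfL x))
  set D := ∫ x, f x ∂μ - ∫ x, f x ∂ρ with hD
  have key : ∀ s : ℝ, 0 ≤ L ^ 2 / 2 * (s * s) + -D * s + klReal μ ρ := by
    intro s
    have hdv := integral_le_klReal_add_log_integral_exp
      (f := fun x => s * (f x - ∫ y, f y ∂ρ)) hμρ
      ((hfμ.sub (integrable_const _)).const_mul s) (hsub.integrable_exp_mul s) h_int
    have hmgf := hsub.mgf_le s
    have hlog : Real.log (∫ x, Real.exp (s * (f x - ∫ y, f y ∂ρ)) ∂ρ) ≤ L ^ 2 * s ^ 2 / 2 := by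
      rw [← Real.log_exp (L ^ 2 * s ^ 2 / 2)]
      refine Real.log_le_log (integral_exp_pos (hsub.integrable_exp_mul s)) (hmgf.trans_eq ?_)
      congr 3
      simp [← two_mul, abs_of_nonneg hL]
    rw [integral_const_mul, integral_sub hfμ (integrable_const _)] at hdv
    simp only [integral_const, probReal_univ, one_smul] at hdv
    rw [← hD] at hdv
    linarith
  have hdisc := discrim_le_zero key
  rw [discrim] at hdisc
  calc D ≤ Real.sqrt (L ^ 2 * (2 * klReal μ ρ)) := Real.le_sqrt_of_sq_le (by linarith)
    _ = L * Real.sqrt (2 * klReal μ ρ) := by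
      rw [Real.sqrt_mul (sq_nonneg L), Real.sqrt_sq hL]

theorem integrable_integral_kernel_of_integrable_bind {X Y : Type*} [MeasurableSpace X]
    [MeasurableSpace Y] {μ : Measure X} [SFinite μ] {κ : Kernel X Y} [IsSFiniteKernel κ]
    {f : Y → ℝ} (hf : Integrable f (μ.bind (fun x => κ x))) :
    Integrable (fun x => ∫ y, f y ∂κ x) μ := by
  have hf' : Integrable f ((κ ∘ₖ Kernel.const Unit μ) ()) := by
    rwa [Kernel.comp_apply, Kernel.const_apply]
  simpa only [Kernel.const_apply] using hf'.integral_comp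

theorem integral_bind_kernel {X Y : Type*} [MeasurableSpace X] [MeasurableSpace Y]
    {μ : Measure X} [SFinite μ] {κ : Kernel X Y} [IsSFiniteKernel κ] {f : Y → ℝ}
    (hf : Integrable f (μ.bind (fun x => κ x))) :
    ∫ y, f y ∂(μ.bind (fun x => κ x)) = ∫ x, ∫ y, f y ∂κ x ∂μ := by
  have hf' : Integrable f ((κ ∘ₖ Kernel.const Unit μ) ()) := by
    rwa [Kernel.comp_apply, Kernel.const_apply]
  simpa only [Kernel.comp_apply, Kernel.const_apply] using Kernel.integral_comp hf'

/-- **Theorem 1 (lower bound).** If `ν`, `q*`, every `κ x` and the mixture `ν.bind κ` are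
mutually absolutely continuous with strictly positive densities and bounded log-density
ratios, and `L ≥ 0` bounds `|log (dν/dq*)|` everywhere, then
`∫ (−KL(κ x ‖ q*)) dν ≤ −KL(ν ‖ q*) + L·√(2·KL(ν ‖ ν.bind κ))`. -/
theorem expected_conditional_kl_lower_bound
    {X : Type*} [MeasurableSpace X]
    (ν qstar : Measure X) [IsProbabilityMeasure ν] [IsProbabilityMeasure qstar]
    (κ : Kernel X X) [IsMarkovKernel κ]
    -- mutual absolute continuity of ν, q*, every κ x, and the mixture ν.bind κ
    (hac1 : ν ≪ qstar) (hac2 : qstar ≪ ν)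
    (hac3 : ∀ x, κ x ≪ qstar) (hac4 : ∀ x, qstar ≪ κ x)
    (hac5 : ν.bind (fun x => κ x) ≪ qstar) (hac6 : qstar ≪ ν.bind (fun x => κ x))
    -- strictly positive densities
    (hpos1 : ∀ᵐ y ∂qstar, 0 < ν.rnDeriv qstar y)
    (hpos2 : ∀ x, ∀ᵐ y ∂qstar, 0 < (κ x).rnDeriv qstar y)
    (hpos3 : ∀ᵐ y ∂qstar, 0 < (ν.bind (fun x => κ x)).rnDeriv qstar y)
    -- bounded log-density ratios
    (hbdd : ∃ C : ℝ, (∀ x y, |llr (κ x) qstar y| ≤ C) ∧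
      (∀ y, |llr ν (ν.bind (fun x => κ x)) y| ≤ C))
    (L : ℝ) (hL : 0 ≤ L) (hLbound : ∀ y, |llr ν qstar y| ≤ L)
    -- measurability of x ↦ KL(κ x ‖ q*)
    (hmeas : Measurable fun x => klReal (κ x) qstar) :
    ∫ x, (- klReal (κ x) qstar) ∂ν ≤
      - klReal ν qstar + L * Real.sqrt (2 * klReal ν (ν.bind (fun x => κ x))) := by
  obtain ⟨C, hκC, hmC⟩ := hbdd
  have hm : IsProbabilityMeasure (ν.bind (fun x => κ x)) :=
    inferInstanceAs (IsProbabilityMeasure (ν.bind κ))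
  set m := ν.bind (fun x => κ x)
  have hg := measurable_llr ν qstar
  have hg_int (μ : Measure X) [IsFiniteMeasure μ] : Integrable (llr ν qstar) μ :=
    .of_bound hg.aestronglyMeasurable L (.of_forall hLbound)
  have hg_exp : Integrable (fun y => Real.exp (llr ν qstar y)) qstar :=
    Measure.integrable_toReal_rnDeriv.congr (exp_llr_of_ac' ν qstar hac2).symm
  have hκ_int (x : X) : Integrable (llr (κ x) qstar) (κ x) :=
    .of_bound (measurable_llr _ _).aestronglyMeasurable C (.of_forall (hκC x))
  have hnorm : ∫ y, Real.exp (llr ν qstar y) ∂qstar = 1 := by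
    rw [integral_congr_ae (exp_llr_of_ac' ν qstar hac2),
      Measure.integral_toReal_rnDeriv hac1, probReal_univ]
  have hpoint (x : X) : ∫ y, llr ν qstar y ∂κ x ≤ klReal (κ x) qstar := by
    simpa [hnorm] using
      integral_le_klReal_add_log_integral_exp (hac3 x) (hg_int _) hg_exp (hκ_int x)
  have hkl_int : Integrable (fun x => klReal (κ x) qstar) ν := by
    refine .of_bound hmeas.aestronglyMeasurable C (.of_forall fun x => ?_)
    simpa [klReal] using norm_integral_le_of_norm_le_const (μ := κ x)
      (f := llr (κ x) qstar) (.of_forall (hκC x))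
  have hmix := integral_bind_kernel (hg_int m)
  have hmono : ∫ x, ∫ y, llr ν qstar y ∂κ x ∂ν ≤ ∫ x, klReal (κ x) qstar ∂ν :=
    integral_mono (integrable_integral_kernel_of_integrable_bind (hg_int m)) hkl_int hpoint
  have hpinsker := integral_sub_integral_le_mul_sqrt_klReal (hac1.trans hac6)
    (.of_bound (measurable_llr ν m).aestronglyMeasurable C (.of_forall hmC)) hg hL hLbound
  rw [integral_neg]
  have hkl : klReal ν qstar = ∫ x, llr ν qstar x ∂ν := rfl
  rw [hkl]
  linarith
end

section
/- For every integer n ≥ 1 and all measurable p, q : X × Z → ℝ such that for every x ∈ X and z ∈ Z the maps x' ↦ p(x',z) and x' ↦ q(x',z) are κ(x)-integrable, it holds that sup_{x ∈ X} ∫ |(𝒫p)(x,z) − (𝒫q)(x,z)|ⁿ dμ(z) ≤ γⁿ · sup_{x ∈ X} ∫ |p(x,z) − q(x,z)|ⁿ dμ(z), where the suprema and integrals are taken with values in [0,∞]. In particular, the operator 𝒫 is γ-contractive in the norm L̄ₙ(f) = (sup_x ∫ |f(x,z)|ⁿ dμ(z))^{1/n}. -/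
open MeasureTheory ProbabilityTheory

/-- Jensen's inequality for natural powers of the integral of a norm over a probability measure. -/
theorem lintegral_enorm_pow_le_lintegral_enorm_pow {X : Type*} [MeasurableSpace X]
    (ν : Measure X) [IsProbabilityMeasure ν] {f : X → ℝ} (hf : AEStronglyMeasurable f ν)
    {n : ℕ} (hn : 1 ≤ n) :
    (∫⁻ x, ‖f x‖ₑ ∂ν) ^ n ≤ ∫⁻ x, ‖f x‖ₑ ^ n ∂ν := by
  have hn0 : (n : ℝ) ≠ 0 := by positivity
  have key := eLpNorm'_le_eLpNorm'_of_exponent_le (μ := ν) (p := 1) (q := n) one_pos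
    (by exact_mod_cast hn) hf
  simp only [eLpNorm', ENNReal.rpow_one, ENNReal.rpow_natCast, div_one] at key
  calc (∫⁻ x, ‖f x‖ₑ ∂ν) ^ n ≤ ((∫⁻ x, ‖f x‖ₑ ^ n ∂ν) ^ (1 / (n : ℝ))) ^ n := by gcongr
    _ = ∫⁻ x, ‖f x‖ₑ ^ n ∂ν := by
      rw [← ENNReal.rpow_natCast, ← ENNReal.rpow_mul, one_div_mul_cancel hn0, ENNReal.rpow_one]

/-- **Theorem 3.** The operator `𝒫` defined by
`(𝒫q)(x,z) = ∫ ((1−γ)·h(x',z) + γ·q(x',z)) dκ(x)(x')`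
is `γ`-contractive in the norm `L̄ₙ(f) = (sup_x ∫ |f(x,z)|ⁿ dμ(z))^{1/n}`:
for every `n ≥ 1`,
`sup_x ∫ |(𝒫p)(x,z) − (𝒫q)(x,z)|ⁿ dμ(z) ≤ γⁿ · sup_x ∫ |p(x,z) − q(x,z)|ⁿ dμ(z)`. -/
theorem operator_P_contraction
    {X Z : Type*} [MeasurableSpace X] [MeasurableSpace Z]
    (μ : Measure Z) [SigmaFinite μ]
    (κ : Kernel X X) [IsMarkovKernel κ]
    (γ : ℝ) (hγ0 : 0 ≤ γ) (hγ1 : γ < 1)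
    (h : X × Z → ℝ) (hhmeas : Measurable h) (hhbdd : ∃ C : ℝ, ∀ p, |h p| ≤ C)
    (n : ℕ) (hn : 1 ≤ n)
    (p q : X × Z → ℝ) (hpmeas : Measurable p) (hqmeas : Measurable q)
    (hpint : ∀ x z, Integrable (fun x' => p (x', z)) (κ x))
    (hqint : ∀ x z, Integrable (fun x' => q (x', z)) (κ x)) :
    (⨆ x : X, ∫⁻ z, ENNReal.ofReal
        (|(∫ x', ((1 - γ) * h (x', z) + γ * p (x', z)) ∂(κ x)) -
          (∫ x', ((1 - γ) * h (x', z) + γ * q (x', z)) ∂(κ x))| ^ n) ∂μ)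
      ≤ ENNReal.ofReal (γ ^ n) *
        ⨆ x : X, ∫⁻ z, ENNReal.ofReal (|p (x, z) - q (x, z)| ^ n) ∂μ := by
  obtain ⟨C, hC⟩ := hhbdd
  have ofReal_abs_pow (a : ℝ) : ENNReal.ofReal (|a| ^ n) = ‖a‖ₑ ^ n := by
    rw [ENNReal.ofReal_pow (abs_nonneg a), Real.enorm_eq_ofReal_abs]
  have hγn : ENNReal.ofReal (γ ^ n) = ‖γ‖ₑ ^ n := by
    rw [← ofReal_abs_pow, abs_of_nonneg hγ0]
  simp only [ofReal_abs_pow, hγn]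
  have hmeas : Measurable fun y : X × Z => ‖p y - q y‖ₑ ^ n :=
    (hpmeas.sub hqmeas).enorm.pow_const n
  refine iSup_le fun x => ?_
  have hdiff (z : Z) :
      (∫ x', ((1 - γ) * h (x', z) + γ * p (x', z)) ∂(κ x)) -
        (∫ x', ((1 - γ) * h (x', z) + γ * q (x', z)) ∂(κ x)) =
      γ * ∫ x', (p (x', z) - q (x', z)) ∂(κ x) := by
    have hh : Integrable (fun x' => (1 - γ) * h (x', z)) (κ x) :=
      (Integrable.of_bound (hhmeas.comp measurable_prodMk_right).aestronglyMeasurable C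
        (ae_of_all _ fun x' => hC (x', z))).const_mul _
    rw [integral_add hh ((hpint x z).const_mul γ), integral_add hh ((hqint x z).const_mul γ),
      add_sub_add_left_eq_sub, integral_const_mul, integral_const_mul,
      integral_sub (hpint x z) (hqint x z), mul_sub]
  calc _ ≤ ∫⁻ z, ‖γ‖ₑ ^ n * ∫⁻ x', ‖p (x', z) - q (x', z)‖ₑ ^ n ∂(κ x) ∂μ := by
        refine lintegral_mono fun z => ?_
        simp only [hdiff, enorm_mul, mul_pow]
        gcongr
        exact (pow_le_pow_left' (enorm_integral_le_lintegral_enorm _) n).trans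
          (lintegral_enorm_pow_le_lintegral_enorm_pow _
            ((hpint x z).sub (hqint x z)).aestronglyMeasurable hn)
    _ = ‖γ‖ₑ ^ n * ∫⁻ x', ∫⁻ z, ‖p (x', z) - q (x', z)‖ₑ ^ n ∂μ ∂(κ x) := by
        rw [lintegral_const_mul _ hmeas.lintegral_prod_left',
          lintegral_lintegral_swap (f := fun x' z => ‖p (x', z) - q (x', z)‖ₑ ^ n)
            hmeas.aemeasurable]
    _ ≤ ‖γ‖ₑ ^ n * ⨆ x, ∫⁻ z, ‖p (x, z) - q (x, z)‖ₑ ^ n ∂μ := by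
        gcongr
        refine (lintegral_mono fun x' =>
          le_iSup (fun x => ∫⁻ z, ‖p (x, z) - q (x, z)‖ₑ ^ n ∂μ) x').trans ?_
        simp
end

section
/- For every integer n ≥ 1 and all measurable p, q : X × X → ℝ such that for every x, x̄ ∈ X the maps x' ↦ p(x',x̄) and x' ↦ q(x',x̄) are κ(x)-integrable, it holds that sup_{x ∈ X} ∫ |(𝒯p)(x,x̄) − (𝒯q)(x,x̄)|ⁿ d(μ_S ⊗ μ_A)(x̄) ≤ γⁿ · sup_{x ∈ X} ∫ |p(x,x̄) − q(x,x̄)|ⁿ d(μ_S ⊗ μ_A)(x̄), where the suprema and integrals are taken with values in [0,∞]. In particular, the operator 𝒯 is γ-contractive in the norm L̄ₙ(f) = (sup_x ∫ |f(x,x̄)|ⁿ d(μ_S ⊗ μ_A)(x̄))^{1/n}. -/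
open MeasureTheory ProbabilityTheory

/-- Jensen's inequality for natural powers of the Lebesgue integral on a probability space. -/
theorem lintegral_pow_le_lintegral_pow {α : Type*} [MeasurableSpace α] (μ : Measure α)
    [IsProbabilityMeasure μ] {n : ℕ} (hn : 1 ≤ n) {g : α → ENNReal} (hg : AEMeasurable g μ) :
    (∫⁻ a, g a ∂μ) ^ n ≤ ∫⁻ a, g a ^ n ∂μ := by
  have h := eLpNorm_le_eLpNorm_of_exponent_le (μ := μ) (p := 1) (q := (n : ENNReal))
    (by exact_mod_cast hn) hg.aestronglyMeasurable
  have hn0 : (n : ENNReal) ≠ 0 := by exact_mod_cast (by omega : n ≠ 0)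
  rw [eLpNorm_one_eq_lintegral_enorm,
    eLpNorm_eq_lintegral_rpow_enorm_toReal hn0 (ENNReal.natCast_ne_top n)] at h
  simp only [enorm_eq_self, ENNReal.toReal_natCast, ENNReal.rpow_natCast] at h
  calc (∫⁻ a, g a ∂μ) ^ n ≤ ((∫⁻ a, g a ^ n ∂μ) ^ (1 / (n : ℝ))) ^ n := by gcongr
    _ = ∫⁻ a, g a ^ n ∂μ := by
      rw [← ENNReal.rpow_natCast, ← ENNReal.rpow_mul, one_div_mul_cancel, ENNReal.rpow_one]
      exact_mod_cast (by omega : n ≠ 0)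

theorem ofReal_abs_pow_eq_enorm_pow (r : ℝ) (n : ℕ) :
    ENNReal.ofReal (|r| ^ n) = ‖r‖ₑ ^ n := by
  rw [ENNReal.ofReal_pow (abs_nonneg r), Real.enorm_eq_ofReal_abs]

/-- **Theorem 2.** The operator `𝒯` defined by
`(𝒯q)((s,a),(s̄,ā)) = (1−γ)·π̂(s̄,ā)·p̂((s,a),s̄) + γ·∫ q(x',(s̄,ā)) dκ(s,a)(x')`
is `γ`-contractive in the norm
`L̄ₙ(f) = (sup_x ∫ |f(x,x̄)|ⁿ d(μ_S ⊗ μ_A)(x̄))^{1/n}`: for every `n ≥ 1`,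
`sup_x ∫ |(𝒯p)(x,x̄) − (𝒯q)(x,x̄)|ⁿ d(μ_S ⊗ μ_A)(x̄)
  ≤ γⁿ · sup_x ∫ |p(x,x̄) − q(x,x̄)|ⁿ d(μ_S ⊗ μ_A)(x̄)`. -/
theorem operator_T_contraction
    {S A : Type*} [MeasurableSpace S] [MeasurableSpace A]
    (μS : Measure S) [SigmaFinite μS] (μA : Measure A) [SigmaFinite μA]
    (κ : Kernel (S × A) (S × A)) [IsMarkovKernel κ]
    (γ : ℝ) (hγ0 : 0 ≤ γ) (hγ1 : γ < 1)
    (phat : (S × A) × S → ℝ) (hpmeas : Measurable phat)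
    (hpnonneg : ∀ y, 0 ≤ phat y) (hpbdd : ∃ C : ℝ, ∀ y, phat y ≤ C)
    (pihat : S × A → ℝ) (hπmeas : Measurable pihat)
    (hπnonneg : ∀ y, 0 ≤ pihat y) (hπbdd : ∃ C : ℝ, ∀ y, pihat y ≤ C)
    (n : ℕ) (hn : 1 ≤ n)
    (p q : (S × A) × (S × A) → ℝ) (hpm : Measurable p) (hqm : Measurable q)
    (hpint : ∀ x xb, Integrable (fun x' => p (x', xb)) (κ x))
    (hqint : ∀ x xb, Integrable (fun x' => q (x', xb)) (κ x)) :
    (⨆ x : S × A, ∫⁻ xb, ENNReal.ofReal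
        (|((1 - γ) * pihat xb * phat (x, xb.1) + γ * ∫ x', p (x', xb) ∂(κ x)) -
          ((1 - γ) * pihat xb * phat (x, xb.1) + γ * ∫ x', q (x', xb) ∂(κ x))| ^ n)
        ∂(μS.prod μA))
      ≤ ENNReal.ofReal (γ ^ n) *
        ⨆ x : S × A, ∫⁻ xb, ENNReal.ofReal (|p (x, xb) - q (x, xb)| ^ n) ∂(μS.prod μA) := by
  have hfm : Measurable fun y => p y - q y := hpm.sub hqm
  simp only [add_sub_add_left_eq_sub, ofReal_abs_pow_eq_enorm_pow]
  refine iSup_le fun x => ?_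
  have hpt : ∀ xb, ‖γ * ∫ x', p (x', xb) ∂(κ x) - γ * ∫ x', q (x', xb) ∂(κ x)‖ₑ ^ n
      ≤ ENNReal.ofReal (γ ^ n) * ∫⁻ x', ‖p (x', xb) - q (x', xb)‖ₑ ^ n ∂(κ x) := fun xb => by
    rw [← mul_sub, ← integral_sub (hpint x xb) (hqint x xb), enorm_mul, mul_pow,
      Real.enorm_of_nonneg hγ0, ENNReal.ofReal_pow hγ0]
    gcongr
    exact (pow_le_pow_left' (enorm_integral_le_lintegral_enorm _) n).trans
      (lintegral_pow_le_lintegral_pow (κ x) hn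
        (hfm.comp measurable_prodMk_right).enorm.aemeasurable)
  calc ∫⁻ xb, ‖γ * ∫ x', p (x', xb) ∂(κ x) - γ * ∫ x', q (x', xb) ∂(κ x)‖ₑ ^ n ∂(μS.prod μA)
      ≤ ∫⁻ xb, ENNReal.ofReal (γ ^ n) * ∫⁻ x', ‖p (x', xb) - q (x', xb)‖ₑ ^ n ∂(κ x)
          ∂(μS.prod μA) := lintegral_mono hpt
    _ = ENNReal.ofReal (γ ^ n) * ∫⁻ x', ∫⁻ xb, ‖p (x', xb) - q (x', xb)‖ₑ ^ n ∂(μS.prod μA)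
          ∂(κ x) := by
      rw [lintegral_const_mul' _ _ ENNReal.ofReal_ne_top, lintegral_lintegral_swap]
      exact ((hfm.enorm.pow_const n).comp measurable_swap).aemeasurable
    _ ≤ _ := by
      gcongr
      exact (lintegral_mono fun x' => le_iSup
        (fun x' => ∫⁻ xb, ‖p (x', xb) - q (x', xb)‖ₑ ^ n ∂(μS.prod μA)) x').trans (by simp)
end

section
/- For every measurable function h : X × Z → [0,∞], the function q(x,z) = ∫⁻ h(x',z) dD(x)(x') is a fixed point of the operator 𝒫: for every x ∈ X and z ∈ Z, ∫⁻ h(x',z) dD(x)(x') = ∫⁻ ( (1−γ)·h(x',z) + γ·∫⁻ h(x'',z) dD(x')(x'') ) dκ(x)(x'). -/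
open MeasureTheory ProbabilityTheory
open scoped ENNReal NNReal

/-- Kernel powers: `kpow κ m = κ^{m+1}`, with `κ¹ = κ` and
`κ^{m+1}(x) = (κ x).bind κ^m`. -/
noncomputable def kpow {X : Type*} [MeasurableSpace X] (κ : X → Measure X) :
    ℕ → X → Measure X
  | 0 => κ
  | (m + 1) => fun x => (κ x).bind (kpow κ m)

/-- Discounted visitation kernel `D(x) = (1−γ)·Σ_{m=1}^∞ γ^{m−1}·κ^m(x)`. -/
noncomputable def dvisit {X : Type*} [MeasurableSpace X] (κ : X → Measure X) (γ : ℝ)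
    (x : X) : Measure X :=
  ENNReal.ofReal (1 - γ) • Measure.sum (fun m : ℕ => ENNReal.ofReal γ ^ m • kpow κ m x)

theorem measurable_kpow {X : Type*} [MeasurableSpace X] {κ : X → Measure X}
    (hκ : Measurable κ) (m : ℕ) : Measurable (kpow κ m) := by
  induction m with
  | zero => exact hκ
  | succ m ih => exact (Measure.measurable_bind' ih).comp hκ

theorem lintegral_kpow_succ {X : Type*} [MeasurableSpace X] {κ : X → Measure X}
    (hκ : Measurable κ) (m : ℕ) {f : X → ℝ≥0∞} (hf : Measurable f) (x : X) :
    ∫⁻ y, f y ∂(kpow κ (m + 1) x) = ∫⁻ x', ∫⁻ y, f y ∂(kpow κ m x') ∂(κ x) :=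
  Measure.lintegral_bind (measurable_kpow hκ m).aemeasurable hf.aemeasurable

theorem lintegral_dvisit {X : Type*} [MeasurableSpace X] (κ : X → Measure X) (γ : ℝ)
    (f : X → ℝ≥0∞) (x : X) :
    ∫⁻ y, f y ∂(dvisit κ γ x) =
      ENNReal.ofReal (1 - γ) * ∑' m : ℕ, ENNReal.ofReal γ ^ m * ∫⁻ y, f y ∂(kpow κ m x) := by
  simp only [dvisit, lintegral_smul_measure, lintegral_sum_measure, smul_eq_mul]

/-- **Theorem 4 (fixed point of `𝒫`).** For every measurable `h : X × Z → [0,∞]`, the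
function `q(x,z) = ∫⁻ h(x',z) dD(x)(x')` is a fixed point of the operator `𝒫`: for all
`x` and `z`,
`∫⁻ h(x',z) dD(x)(x') = ∫⁻ ((1−γ)·h(x',z) + γ·∫⁻ h(x'',z) dD(x')(x'')) dκ(x)(x')`. -/
theorem dvisit_feature_fixed_point
    {X Z : Type*} [MeasurableSpace X] [MeasurableSpace Z]
    (κ : Kernel X X) [IsMarkovKernel κ]
    (γ : ℝ) (hγ0 : 0 ≤ γ) (hγ1 : γ < 1)
    (h : X × Z → ℝ≥0∞) (hh : Measurable h) (x : X) (z : Z) :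
    ∫⁻ x', h (x', z) ∂(dvisit (fun y => κ y) γ x) =
      ∫⁻ x', (ENNReal.ofReal (1 - γ) * h (x', z) +
        ENNReal.ofReal γ * ∫⁻ x'', h (x'', z) ∂(dvisit (fun y => κ y) γ x')) ∂(κ x) := by
  have hκ : Measurable (fun y => κ y) := κ.measurable
  have hf : Measurable fun y => h (y, z) := hh.comp measurable_prodMk_right
  have hI (m : ℕ) : Measurable fun x' => ∫⁻ y, h (y, z) ∂(kpow (fun y => κ y) m x') :=
    (Measure.measurable_lintegral hf).comp (measurable_kpow hκ m)
  simp only [lintegral_dvisit]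
  rw [lintegral_add_left (hf.const_mul _), lintegral_const_mul _ hf,
    lintegral_const_mul _ ((Measurable.tsum fun m => (hI m).const_mul _).const_mul _),
    lintegral_const_mul _ (Measurable.tsum fun m => (hI m).const_mul _),
    lintegral_tsum fun m => ((hI m).const_mul _).aemeasurable,
    tsum_eq_zero_add' ENNReal.summable, mul_add, mul_left_comm (ENNReal.ofReal γ),
    ← ENNReal.tsum_mul_left (a := ENNReal.ofReal γ)]
  congr 1
  · simp [kpow]
  · refine congrArg _ (tsum_congr fun m => ?_)
    rw [lintegral_kpow_succ hκ m hf, lintegral_const_mul _ (hI m), pow_succ', mul_assoc]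
end

section
/- For every integer N ≥ 1 and all measurable functions h, q : X × Z → [0,∞], the N-th iterate of the operator 𝒫 satisfies, for every x ∈ X and z ∈ Z: (𝒫^N q)(x,z) = Σ_{Δ=1}^{N} (1−γ)·γ^{Δ−1}·∫⁻ h(x',z) dκ^Δ(x)(x') + γ^N·∫⁻ q(x',z) dκ^N(x)(x'). -/
open MeasureTheory ProbabilityTheory
open scoped ENNReal NNReal

/-- The operator `𝒫`:
`(𝒫q)(x,z) = ∫⁻ ((1−γ)·h(x',z) + γ·q(x',z)) dκ(x)(x')`. -/
noncomputable def Pop {X Z : Type*} [MeasurableSpace X] [MeasurableSpace Z]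
    (κ : X → Measure X) (γ : ℝ) (h : X × Z → ℝ≥0∞) (q : X × Z → ℝ≥0∞) :
    X × Z → ℝ≥0∞ :=
  fun p =>
    ∫⁻ x', (ENNReal.ofReal (1 - γ) * h (x', p.2) + ENNReal.ofReal γ * q (x', p.2)) ∂(κ p.1)

theorem measurable_lintegral_kpow {X : Type*} [MeasurableSpace X] {κ : X → Measure X}
    (hκ : Measurable κ) (m : ℕ) {f : X → ℝ≥0∞} (hf : Measurable f) :
    Measurable fun x => ∫⁻ y, f y ∂(kpow κ m x) :=
  (Measure.measurable_lintegral hf).comp (measurable_kpow hκ m)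

theorem Pop_iterate_succ_eq {X Z : Type*} [MeasurableSpace X] [MeasurableSpace Z]
    {κ : X → Measure X} (hκ : Measurable κ) (γ : ℝ) {h q : X × Z → ℝ≥0∞}
    (hh : Measurable h) (hq : Measurable q) (n : ℕ) (x : X) (z : Z) :
    (Pop κ γ h)^[n + 1] q (x, z) =
      (∑ i ∈ Finset.range (n + 1), ENNReal.ofReal (1 - γ) * ENNReal.ofReal γ ^ i *
        ∫⁻ x', h (x', z) ∂(kpow κ i x)) +
      ENNReal.ofReal γ ^ (n + 1) * ∫⁻ x', q (x', z) ∂(kpow κ n x) := by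
  have hhz : Measurable fun y => h (y, z) := hh.comp measurable_prodMk_right
  have hqz : Measurable fun y => q (y, z) := hq.comp measurable_prodMk_right
  have mh (i : ℕ) := measurable_lintegral_kpow hκ i hhz
  have mq (i : ℕ) := measurable_lintegral_kpow hκ i hqz
  induction n generalizing x with
  | zero =>
    simp [Pop, kpow, lintegral_add_left (hhz.const_mul _), lintegral_const_mul _ hhz,
      lintegral_const_mul _ hqz]
  | succ n ih =>
    rw [Function.iterate_succ_apply']
    simp only [Pop] at ih ⊢
    simp only [ih]
    have ms : Measurable fun x => ∑ i ∈ Finset.range (n + 1),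
        ENNReal.ofReal (1 - γ) * ENNReal.ofReal γ ^ i * ∫⁻ x', h (x', z) ∂(kpow κ i x) :=
      Finset.measurable_fun_sum _ fun i _ => (mh i).const_mul _
    have msq : Measurable fun x => (∑ i ∈ Finset.range (n + 1),
        ENNReal.ofReal (1 - γ) * ENNReal.ofReal γ ^ i * ∫⁻ x', h (x', z) ∂(kpow κ i x)) +
        ENNReal.ofReal γ ^ (n + 1) * ∫⁻ x', q (x', z) ∂(kpow κ n x) :=
      ms.add ((mq n).const_mul _)
    rw [lintegral_add_left (hhz.const_mul _), lintegral_const_mul _ hhz,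
      lintegral_const_mul _ msq, lintegral_add_left ms,
      lintegral_const_mul _ (mq n),
      lintegral_finsetSum _ fun i _ => (mh i).const_mul _, Finset.sum_range_succ' _ (n + 1)]
    simp only [lintegral_const_mul _ (mh _), lintegral_kpow_succ hκ _ hhz,
      lintegral_kpow_succ hκ _ hqz, mul_add, Finset.mul_sum]
    simp only [kpow, pow_succ, pow_zero, mul_one]
    rw [← add_assoc, add_comm (ENNReal.ofReal (1 - γ) * _)]
    congr 1
    · congr 1
      exact Finset.sum_congr rfl fun i _ => by ring
    · ring

/-- The `N`-th iterate of the operator `𝒫` satisfies, for every `x` and `z`: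
`(𝒫^N q)(x,z) = Σ_{Δ=1}^{N} (1−γ)·γ^{Δ−1}·∫⁻ h(x',z) dκ^Δ(x)(x')
  + γ^N·∫⁻ q(x',z) dκ^N(x)(x')`, where `κ^Δ = kpow κ (Δ−1)`. -/
theorem Pop_iterate_eq
    {X Z : Type*} [MeasurableSpace X] [MeasurableSpace Z]
    (κ : Kernel X X) [IsMarkovKernel κ]
    (γ : ℝ) (hγ0 : 0 ≤ γ) (hγ1 : γ < 1)
    (N : ℕ) (hN : 1 ≤ N)
    (h q : X × Z → ℝ≥0∞) (hh : Measurable h) (hq : Measurable q) (x : X) (z : Z) :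
    (Pop (fun y => κ y) γ h)^[N] q (x, z) =
      (∑ Δ ∈ Finset.Icc 1 N, ENNReal.ofReal (1 - γ) * ENNReal.ofReal γ ^ (Δ - 1) *
        ∫⁻ x', h (x', z) ∂(kpow (fun y => κ y) (Δ - 1) x)) +
      ENNReal.ofReal γ ^ N * ∫⁻ x', q (x', z) ∂(kpow (fun y => κ y) (N - 1) x) := by
  obtain ⟨n, rfl⟩ : ∃ n, N = n + 1 := ⟨N - 1, by omega⟩
  rw [Pop_iterate_succ_eq κ.measurable γ hh hq, ← Finset.Ico_add_one_right_eq_Icc,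
    Finset.sum_Ico_eq_sum_range]
  simp only [Nat.add_sub_cancel, Nat.add_sub_cancel_left]
end

section
/- For every integer N ≥ 1 and all measurable functions h, q : X × Z → [0,∞], the N-th iterate of the operator 𝒫 is the geometric mixture: for every x ∈ X and z ∈ Z, (𝒫^N q)(x,z) = Σ_{Δ=1}^{∞} (1−γ)·γ^{Δ−1}·∫⁻ b_Δ(x',z) dκ^{min(Δ,N)}(x)(x'), where b_Δ = h for Δ ≤ N and b_Δ = q for Δ > N. -/
open MeasureTheory ProbabilityTheory
open scoped ENNReal NNReal

/-- The `(n+1)`-st iterate of `Pop` as a finite sum with a bootstrapped remainder. -/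
theorem Pop_iterate_succ_eq_sum {X Z : Type*} [MeasurableSpace X] [MeasurableSpace Z]
    {κ : X → Measure X} (hκ : Measurable κ) (γ : ℝ) {h q : X × Z → ℝ≥0∞}
    (hh : Measurable h) (hq : Measurable q) (n : ℕ) (x : X) (z : Z) :
    (Pop κ γ h)^[n + 1] q (x, z) =
      ∑ i ∈ Finset.range (n + 1), ENNReal.ofReal (1 - γ) * ENNReal.ofReal γ ^ i *
          ∫⁻ x', h (x', z) ∂(kpow κ i x) +
        ENNReal.ofReal γ ^ (n + 1) * ∫⁻ x', q (x', z) ∂(kpow κ n x) := by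
  have hhz : Measurable fun x' => h (x', z) := hh.comp measurable_prodMk_right
  have hqz : Measurable fun x' => q (x', z) := hq.comp measurable_prodMk_right
  induction n generalizing x with
  | zero =>
    simp only [zero_add, Function.iterate_one, Finset.sum_range_one, pow_zero, mul_one, pow_one,
      Pop, kpow]
    rw [lintegral_add_left (hhz.const_mul _), lintegral_const_mul _ hhz,
      lintegral_const_mul _ hqz]
  | succ n ih =>
    have hH (i : ℕ) := measurable_lintegral_kpow hκ i hhz
    have hQ := measurable_lintegral_kpow hκ n hqz
    rw [Function.iterate_succ_apply', Pop]
    simp only [ih]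
    rw [lintegral_add_left (hhz.const_mul _), lintegral_const_mul _ hhz,
      lintegral_const_mul' _ _ ENNReal.ofReal_ne_top,
      lintegral_add_right _ (hQ.const_mul _), lintegral_const_mul _ hQ,
      lintegral_finsetSum _ fun i _ => (hH i).const_mul _,
      Finset.sum_range_succ' _ (n + 1), lintegral_kpow_succ hκ n hqz]
    simp only [lintegral_const_mul _ (hH _), lintegral_kpow_succ hκ _ hhz]
    rw [mul_add, Finset.mul_sum, ← add_assoc, add_comm (ENNReal.ofReal (1 - γ) * _)]
    congr 1
    · congr 1
      · refine Finset.sum_congr rfl fun i _ => ?_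
        ring
      · simp [kpow]
    · ring

/-- The weights of a geometric distribution sum to one. -/
theorem tsum_ofReal_one_sub_mul_pow {γ : ℝ} (hγ0 : 0 ≤ γ) (hγ1 : γ < 1) :
    ∑' i : ℕ, ENNReal.ofReal (1 - γ) * ENNReal.ofReal γ ^ i = 1 := by
  rw [ENNReal.tsum_mul_left, ENNReal.tsum_geometric, ENNReal.ofReal_sub _ hγ0,
    ENNReal.ofReal_one]
  refine ENNReal.mul_inv_cancel ?_ (by simp)
  simpa [tsub_eq_zero_iff_le] using hγ1

/-- The `N`-th iterate of `𝒫` is the geometric mixture: for every `x` and `z`,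
`(𝒫^N q)(x,z) = Σ_{Δ=1}^{∞} (1−γ)·γ^{Δ−1}·∫⁻ b_Δ(x',z) dκ^{min(Δ,N)}(x)(x')`,
where `b_Δ = h` for `Δ ≤ N` and `b_Δ = q` for `Δ > N`. Below, the summation index
`Δ : ℕ` stands for the paper's `Δ − 1`, and `κ^m = kpow κ (m−1)`. -/
theorem Pop_iterate_geometric_mixture
    {X Z : Type*} [MeasurableSpace X] [MeasurableSpace Z]
    (κ : Kernel X X) [IsMarkovKernel κ]
    (γ : ℝ) (hγ0 : 0 ≤ γ) (hγ1 : γ < 1)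
    (N : ℕ) (hN : 1 ≤ N)
    (h q : X × Z → ℝ≥0∞) (hh : Measurable h) (hq : Measurable q) (x : X) (z : Z) :
    (Pop (fun y => κ y) γ h)^[N] q (x, z) =
      ∑' Δ : ℕ, ENNReal.ofReal (1 - γ) * ENNReal.ofReal γ ^ Δ *
        ∫⁻ x', (if Δ + 1 ≤ N then h (x', z) else q (x', z))
          ∂(kpow (fun y => κ y) (min (Δ + 1) N - 1) x) := by
  obtain ⟨n, rfl⟩ := Nat.exists_eq_add_of_le' hN
  rw [Pop_iterate_succ_eq_sum κ.measurable γ hh hq,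
    ← (ENNReal.summable).sum_add_tsum_nat_add' (k := n + 1)]
  congr 1
  · refine Finset.sum_congr rfl fun i hi => ?_
    have hi' : i + 1 ≤ n + 1 := Finset.mem_range.mp hi
    simp only [if_pos hi', min_eq_left hi', Nat.add_sub_cancel]
  · have hlt (i : ℕ) : ¬ i + (n + 1) + 1 ≤ n + 1 := by lia
    have hmin (i : ℕ) : min (i + (n + 1) + 1) (n + 1) - 1 = n := by lia
    simp only [if_neg (hlt _), hmin, pow_add _ _ (n + 1), ← mul_assoc]
    simp only [ENNReal.tsum_mul_right, tsum_ofReal_one_sub_mul_pow hγ0 hγ1, one_mul]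
end

section
/- The Kullback–Leibler divergence of a mixture is bounded by the mixture of Kullback–Leibler divergences: KL(ν.bind κ ‖ q*) ≤ ∫_X KL(κ(x) ‖ q*) dν(x), where the integral is a Lebesgue lower integral with values in [0,∞]. -/
open MeasureTheory ProbabilityTheory
open scoped ENNReal

open scoped Classical

/-- Kullback–Leibler divergence with values in `[0,∞]`, equal to
`∫ log (dμ/dρ) dμ` when `μ ≪ ρ` and the log-likelihood ratio is integrable,
and to `∞` otherwise. -/
noncomputable def klDiv {Y : Type*} [MeasurableSpace Y] (μ ρ : Measure Y) : ℝ≥0∞ :=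
  if μ ≪ ρ ∧ Integrable (llr μ ρ) μ then ENNReal.ofReal (∫ y, llr μ ρ y ∂μ) else ⊤

lemma klDiv_eq_informationTheory_klDiv {Y : Type*} [MeasurableSpace Y] (μ ρ : Measure Y)
    [IsProbabilityMeasure μ] [IsProbabilityMeasure ρ] :
    klDiv μ ρ = InformationTheory.klDiv μ ρ := by
  rw [klDiv, InformationTheory.klDiv_def]
  simp

/-- Fenchel–Young inequality for `klFun`. -/
lemma mul_sub_le_klFun {t : ℝ} (ht : 0 ≤ t) (s : ℝ) :
    t * s - (Real.exp s - 1) ≤ InformationTheory.klFun t := by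
  rw [InformationTheory.klFun_apply]
  rcases ht.eq_or_lt with rfl | ht
  · simp [Real.exp_nonneg]
  · have h := mul_le_mul_of_nonneg_left (Real.add_one_le_exp (s - Real.log t)) ht.le
    rw [Real.exp_sub, Real.exp_log ht, mul_div_cancel₀ _ ht.ne'] at h
    linarith

lemma integrable_of_abs_le {Y : Type*} [MeasurableSpace Y] {μ : Measure Y} [IsFiniteMeasure μ]
    {s : Y → ℝ} (hs : Measurable s) {C : ℝ} (hC : ∀ y, |s y| ≤ C) : Integrable s μ :=
  .of_bound hs.aestronglyMeasurable C (.of_forall hC)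

lemma integrable_exp_sub_one {Y : Type*} [MeasurableSpace Y] {μ : Measure Y} [IsFiniteMeasure μ]
    {s : Y → ℝ} (hs : Measurable s) {C : ℝ} (hC : ∀ y, |s y| ≤ C) :
    Integrable (fun y => Real.exp (s y) - 1) μ := by
  refine (Integrable.of_bound (C := Real.exp C) (by fun_prop) (.of_forall fun y => ?_)).sub
    (integrable_const 1)
  rw [Real.norm_eq_abs, Real.abs_exp]
  exact Real.exp_le_exp.2 ((le_abs_self _).trans (hC y))

lemma integral_rnDeriv_mul_sub {Y : Type*} [MeasurableSpace Y] {μ ρ : Measure Y}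
    [IsFiniteMeasure μ] [IsFiniteMeasure ρ] (hμρ : μ ≪ ρ)
    {s : Y → ℝ} (hs : Measurable s) {C : ℝ} (hC : ∀ y, |s y| ≤ C) :
    Integrable (fun y => (μ.rnDeriv ρ y).toReal * s y - (Real.exp (s y) - 1)) ρ ∧
      ∫ y, ((μ.rnDeriv ρ y).toReal * s y - (Real.exp (s y) - 1)) ∂ρ
        = ∫ y, s y ∂μ - ∫ y, (Real.exp (s y) - 1) ∂ρ := by
  have h₁ : Integrable (fun y => (μ.rnDeriv ρ y).toReal * s y) ρ :=
    (integrable_rnDeriv_smul_iff hμρ).2 (integrable_of_abs_le hs hC)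
  have h₂ := integrable_exp_sub_one (μ := ρ) hs hC
  refine ⟨h₁.sub h₂, ?_⟩
  rw [integral_sub h₁ h₂, integral_toReal_rnDeriv_mul hμρ]

/-- Variational lower bound for the Kullback–Leibler divergence. -/
lemma ofReal_integral_sub_le_klDiv {Y : Type*} [MeasurableSpace Y] {μ ρ : Measure Y}
    [IsFiniteMeasure μ] [IsFiniteMeasure ρ]
    {s : Y → ℝ} (hs : Measurable s) {C : ℝ} (hC : ∀ y, |s y| ≤ C) :
    ENNReal.ofReal (∫ y, s y ∂μ - ∫ y, (Real.exp (s y) - 1) ∂ρ)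
      ≤ InformationTheory.klDiv μ ρ := by
  by_cases hμρ : μ ≪ ρ
  swap; · simp [hμρ]
  by_cases hint : Integrable (llr μ ρ) μ
  swap; · simp [hint]
  rw [InformationTheory.klDiv_eq_integral_klFun, if_pos ⟨hμρ, hint⟩]
  obtain ⟨h₁, h₂⟩ := integral_rnDeriv_mul_sub hμρ hs hC
  rw [← h₂]
  exact ENNReal.ofReal_le_ofReal (integral_mono h₁
    ((InformationTheory.integrable_klFun_rnDeriv_iff hμρ).2 hint)
    fun y => mul_sub_le_klFun ENNReal.toReal_nonneg _)

/-- The logarithm of `t` clamped to the interval `[b⁻¹, b]`. -/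
noncomputable def clampLog (b t : ℝ) : ℝ := Real.log (max (min t b) b⁻¹)

lemma measurable_clampLog (b : ℝ) : Measurable (clampLog b) := by
  unfold clampLog
  fun_prop

lemma abs_clampLog_le {b : ℝ} (hb : 1 ≤ b) (t : ℝ) : |clampLog b t| ≤ Real.log b := by
  have hb₀ : 0 < b := by linarith
  have hb₁ : b⁻¹ ≤ b := (inv_le_one_of_one_le₀ hb).trans hb
  rw [clampLog, abs_le, ← Real.log_inv]
  exact ⟨Real.log_le_log (by positivity) (le_max_right _ _),
    Real.log_le_log (by positivity) (max_le (min_le_right _ _) hb₁)⟩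

lemma exp_clampLog {b : ℝ} (hb : 1 ≤ b) (t : ℝ) :
    Real.exp (clampLog b t) = max (min t b) b⁻¹ :=
  Real.exp_log (by positivity)

lemma mul_clampLog_sub_nonneg {b : ℝ} (hb : 1 ≤ b) (t : ℝ) :
    0 ≤ t * clampLog b t - (Real.exp (clampLog b t) - 1) := by
  have hb₁ : b⁻¹ ≤ 1 := inv_le_one_of_one_le₀ hb
  have hpos : 0 < max (min t b) b⁻¹ := by positivity
  have hkl := InformationTheory.klFun_nonneg hpos.le
  rw [InformationTheory.klFun_apply] at hkl
  rw [exp_clampLog hb, clampLog]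
  suffices 0 ≤ (t - max (min t b) b⁻¹) * Real.log (max (min t b) b⁻¹) by linarith
  rcases le_total t b⁻¹ with h | h
  · rw [max_eq_right ((min_le_left _ _).trans h)]
    exact mul_nonneg_of_nonpos_of_nonpos (by linarith)
      (Real.log_nonpos (by positivity) hb₁)
  rcases le_total t b with h' | h'
  · rw [min_eq_left h', max_eq_left h]
    simp
  · rw [min_eq_right h', max_eq_left (hb₁.trans hb)]
    exact mul_nonneg (by linarith) (Real.log_nonneg hb)

lemma tendsto_mul_clampLog_sub {t : ℝ} (ht : 0 ≤ t) :
    Filter.Tendsto (fun b => t * clampLog b t - (Real.exp (clampLog b t) - 1)) Filter.atTop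
      (nhds (InformationTheory.klFun t)) := by
  rcases ht.eq_or_lt with rfl | ht
  · have h : Filter.Tendsto (fun b : ℝ => 1 - b⁻¹) Filter.atTop (nhds (1 - 0)) :=
      tendsto_inv_atTop_zero.const_sub 1
    rw [InformationTheory.klFun_zero]
    rw [sub_zero] at h
    refine h.congr' ?_
    filter_upwards [Filter.eventually_ge_atTop 1] with b hb
    have hb₀ : 0 ≤ b := by linarith
    rw [exp_clampLog hb, min_eq_left hb₀, max_eq_right (by positivity)]
    ring
  · refine tendsto_const_nhds.congr' ?_
    filter_upwards [Filter.eventually_ge_atTop 1, Filter.eventually_ge_atTop t,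
      Filter.eventually_ge_atTop t⁻¹] with b hb hb₁ hb₂
    rw [exp_clampLog hb, clampLog, min_eq_left hb₁, max_eq_left (inv_le_of_inv_le₀ ht hb₂),
      InformationTheory.klFun_apply]
    ring

/-- Converse of `ofReal_integral_sub_le_klDiv`: an upper bound for the variational functional on
bounded functions is an upper bound for the Kullback–Leibler divergence. -/
lemma klDiv_le_of_forall_ofReal_integral_sub_le {Y : Type*} [MeasurableSpace Y] {μ ρ : Measure Y}
    [IsFiniteMeasure μ] [IsFiniteMeasure ρ] (hμρ : μ ≪ ρ) {c : ℝ≥0∞}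
    (hc : ∀ s : Y → ℝ, Measurable s → ∀ C : ℝ, (∀ y, |s y| ≤ C) →
      ENNReal.ofReal (∫ y, s y ∂μ - ∫ y, (Real.exp (s y) - 1) ∂ρ) ≤ c) :
    InformationTheory.klDiv μ ρ ≤ c := by
  rw [InformationTheory.klDiv_eq_lintegral_klFun_of_ac hμρ]
  let b : ℕ → ℝ := fun n => n + 1
  have hb (n : ℕ) : 1 ≤ b n := by simp [b]
  have hb_top : Filter.Tendsto b Filter.atTop Filter.atTop :=
    Filter.tendsto_atTop_add_const_right _ 1 tendsto_natCast_atTop_atTop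
  let s : ℕ → Y → ℝ := fun n y => clampLog (b n) (μ.rnDeriv ρ y).toReal
  have hs (n : ℕ) : Measurable (s n) :=
    (measurable_clampLog _).comp (μ.measurable_rnDeriv ρ).ennreal_toReal
  have hsC (n : ℕ) (y : Y) : |s n y| ≤ Real.log (b n) := abs_clampLog_le (hb n) _
  let F : ℕ → Y → ℝ≥0∞ := fun n y =>
    ENNReal.ofReal ((μ.rnDeriv ρ y).toReal * s n y - (Real.exp (s n y) - 1))
  have hF (n : ℕ) : Measurable (F n) :=
    (((μ.measurable_rnDeriv ρ).ennreal_toReal.mul (hs n)).sub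
      ((Real.measurable_exp.comp (hs n)).sub_const 1)).ennreal_ofReal
  have hF_le (n : ℕ) : ∫⁻ y, F n y ∂ρ ≤ c := by
    obtain ⟨h₁, h₂⟩ := integral_rnDeriv_mul_sub hμρ (hs n) (hsC n)
    rw [← ofReal_integral_eq_lintegral_ofReal h₁
      (.of_forall fun y => mul_clampLog_sub_nonneg (hb n) _), h₂]
    exact hc _ (hs n) _ (hsC n)
  calc ∫⁻ y, ENNReal.ofReal (InformationTheory.klFun (μ.rnDeriv ρ y).toReal) ∂ρ
      = ∫⁻ y, Filter.liminf (fun n => F n y) Filter.atTop ∂ρ := by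
        refine lintegral_congr fun y => (Filter.Tendsto.liminf_eq ?_).symm
        exact ENNReal.tendsto_ofReal
          ((tendsto_mul_clampLog_sub ENNReal.toReal_nonneg).comp hb_top)
    _ ≤ Filter.liminf (fun n => ∫⁻ y, F n y ∂ρ) Filter.atTop := lintegral_liminf_le hF
    _ ≤ c := Filter.liminf_le_of_le (by isBoundedDefault) fun d hd => by
        obtain ⟨n, hn⟩ := hd.exists
        exact hn.trans (hF_le n)

lemma ofReal_integral_le_lintegral_ofReal {X : Type*} [MeasurableSpace X] {ν : Measure X}
    {f : X → ℝ} (hf : Integrable f ν) :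
    ENNReal.ofReal (∫ x, f x ∂ν) ≤ ∫⁻ x, ENNReal.ofReal (f x) ∂ν := by
  rw [integral_eq_lintegral_pos_part_sub_lintegral_neg_part hf]
  exact (ENNReal.ofReal_le_ofReal (sub_le_self _ ENNReal.toReal_nonneg)).trans
    ENNReal.ofReal_toReal_le

lemma comp_absolutelyContinuous_of_ae {X Y : Type*} [MeasurableSpace X] [MeasurableSpace Y]
    {ν : Measure X} {κ : Kernel X Y} {ρ : Measure Y} (h : ∀ᵐ x ∂ν, κ x ≪ ρ) :
    ν.bind κ ≪ ρ := by
  refine Measure.AbsolutelyContinuous.mk fun B hB hρB => ?_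
  rw [Measure.bind_apply hB κ.aemeasurable, lintegral_eq_zero_iff (κ.measurable_coe hB)]
  filter_upwards [h] with x hx using hx hρB

/-- The Kullback–Leibler divergence of a mixture is bounded by the mixture of
Kullback–Leibler divergences: `KL(ν.bind κ ‖ q*) ≤ ∫⁻ KL(κ x ‖ q*) dν(x)`. -/
theorem klDiv_bind_le_lintegral_klDiv
    {X Y : Type*} [MeasurableSpace X] [MeasurableSpace Y]
    (ν : Measure X) [IsProbabilityMeasure ν]
    (κ : Kernel X Y) [IsMarkovKernel κ]
    (qstar : Measure Y) [IsProbabilityMeasure qstar]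
    (hmeas : Measurable fun x => klDiv (κ x) qstar) :
    klDiv (ν.bind (fun x => κ x)) qstar ≤ ∫⁻ x, klDiv (κ x) qstar ∂ν := by
  by_cases htop : ∫⁻ x, klDiv (κ x) qstar ∂ν = ∞
  · simp [htop]
  have hac : ∀ᵐ x ∂ν, κ x ≪ qstar := by
    filter_upwards [ae_lt_top hmeas htop] with x hx
    by_contra hnot
    simp [klDiv, hnot] at hx
  change klDiv (ν.bind κ) qstar ≤ _
  rw [klDiv_eq_informationTheory_klDiv]
  refine klDiv_le_of_forall_ofReal_integral_sub_le (comp_absolutelyContinuous_of_ae hac)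
    fun s hs C hC => ?_
  have hs_int : Integrable s ((κ ∘ₖ Kernel.const Unit ν) ()) := integrable_of_abs_le hs hC
  have hint : Integrable (fun x => ∫ y, s y ∂κ x) ν := hs_int.integral_comp
  calc ENNReal.ofReal (∫ y, s y ∂(ν.bind κ) - ∫ y, (Real.exp (s y) - 1) ∂qstar)
      = ENNReal.ofReal (∫ x, (∫ y, s y ∂κ x - ∫ y, (Real.exp (s y) - 1) ∂qstar) ∂ν) := by
        rw [integral_sub hint (integrable_const _), Measure.comp_eq_comp_const_apply,
          Kernel.integral_comp hs_int]
        simp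
    _ ≤ ∫⁻ x, ENNReal.ofReal (∫ y, s y ∂κ x - ∫ y, (Real.exp (s y) - 1) ∂qstar) ∂ν :=
        ofReal_integral_le_lintegral_ofReal (hint.sub (integrable_const _))
    _ ≤ ∫⁻ x, klDiv (κ x) qstar ∂ν := lintegral_mono fun x => by
        rw [klDiv_eq_informationTheory_klDiv]
        exact ofReal_integral_sub_le_klDiv hs hC
end

section
/- Suppose that ν, q*, and every κ(x) (for x ∈ X) are mutually absolutely continuous with strictly positive densities and bounded log-density ratios. Then ∫_X KL(κ(x) ‖ q*) dν(x) ≥ ∫_X log(dν/dq*)(y) d(ν.bind κ)(y); that is, replacing the conditional density by the marginal density inside the logarithm can only decrease the expected divergence. -/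
open MeasureTheory ProbabilityTheory

/-- Chain rule for log-likelihood ratios: `log (dμ/dν) = log (dμ/dρ) - log (dν/dρ)`. -/
lemma llr_ae_eq_llr_sub_llr {X : Type*} [MeasurableSpace X] {μ ν ρ : Measure X}
    [SigmaFinite μ] [SigmaFinite ν] [SigmaFinite ρ] (hμν : μ ≪ ν) (hνρ : ν ≪ ρ) :
    llr μ ν =ᵐ[μ] fun y => llr μ ρ y - llr ν ρ y := by
  filter_upwards [hμν (Measure.rnDeriv_mul_rnDeriv' (μ := μ) hνρ),
    Measure.rnDeriv_pos hμν, hμν (μ.rnDeriv_lt_top ν),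
    hμν (Measure.rnDeriv_pos hνρ), (hμν.trans hνρ) (ν.rnDeriv_lt_top ρ)]
    with y hy hpos htop hpos' htop'
  rw [llr, llr, llr, ← hy, Pi.mul_apply, ENNReal.toReal_mul,
    Real.log_mul (ENNReal.toReal_pos hpos.ne' htop.ne).ne'
      (ENNReal.toReal_pos hpos'.ne' htop'.ne).ne']
  ring

/-- Gibbs' inequality: `∫ log (dν/dρ) dμ ≤ ∫ log (dμ/dρ) dμ`. -/
lemma integral_llr_le_klReal {X : Type*} [MeasurableSpace X] {μ ν ρ : Measure X}
    [IsProbabilityMeasure μ] [IsProbabilityMeasure ν] [SigmaFinite ρ]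
    (hμν : μ ≪ ν) (hνρ : ν ≪ ρ) (hμ : Integrable (llr μ ρ) μ) (hν : Integrable (llr ν ρ) μ) :
    ∫ y, llr ν ρ y ∂μ ≤ klReal μ ρ := by
  have hchain := llr_ae_eq_llr_sub_llr hμν hνρ
  have hnonneg := InformationTheory.integral_llr_add_sub_measure_univ_nonneg hμν
    ((hμ.sub hν).congr hchain.symm)
  rw [integral_congr_ae hchain, integral_sub hμ hν] at hnonneg
  simp only [probReal_univ] at hnonneg
  rw [klReal]
  linarith

/-- If `ν`, `q*` and every `κ x` are mutually absolutely continuous with strictly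
positive densities and bounded log-density ratios, then
`∫ KL(κ x ‖ q*) dν(x) ≥ ∫ log (dν/dq*) d(ν.bind κ)`: replacing the conditional
density by the marginal density inside the logarithm can only decrease the
expected divergence. -/
theorem lintegral_klReal_ge_mixture_llr
    {X : Type*} [MeasurableSpace X]
    (ν qstar : Measure X) [IsProbabilityMeasure ν] [IsProbabilityMeasure qstar]
    (κ : Kernel X X) [IsMarkovKernel κ]
    -- mutual absolute continuity of ν, q*, and every κ x
    (hac1 : ν ≪ qstar) (hac2 : qstar ≪ ν)
    (hac3 : ∀ x, κ x ≪ qstar) (hac4 : ∀ x, qstar ≪ κ x)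
    -- strictly positive densities
    (hpos1 : ∀ᵐ y ∂qstar, 0 < ν.rnDeriv qstar y)
    (hpos2 : ∀ x, ∀ᵐ y ∂qstar, 0 < (κ x).rnDeriv qstar y)
    -- bounded log-density ratios
    (hbdd : ∃ C : ℝ, (∀ x y, |llr (κ x) qstar y| ≤ C) ∧ (∀ y, |llr ν qstar y| ≤ C))
    -- measurability of x ↦ KL(κ x ‖ q*)
    (hmeas : Measurable fun x => klReal (κ x) qstar) :
    ∫ y, llr ν qstar y ∂(ν.bind (fun x => κ x)) ≤ ∫ x, klReal (κ x) qstar ∂ν := by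
  obtain ⟨C, hκ, hν⟩ := hbdd
  have integrable_llr_left (x : X) : Integrable (llr (κ x) qstar) (κ x) :=
    .of_bound (stronglyMeasurable_llr _ _).aestronglyMeasurable C (.of_forall (hκ x))
  have integrable_llr (μ : Measure X) [IsFiniteMeasure μ] : Integrable (llr ν qstar) μ :=
    .of_bound (stronglyMeasurable_llr _ _).aestronglyMeasurable C (.of_forall hν)
  have integrable_klReal : Integrable (fun x => klReal (κ x) qstar) ν := by
    refine .of_bound hmeas.aestronglyMeasurable C (.of_forall fun x => ?_)
    simpa [klReal] using norm_integral_le_of_norm_le_const (μ := κ x)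
      (f := llr (κ x) qstar) (.of_forall (hκ x))
  have integrable_comp : Integrable (llr ν qstar) ((κ ∘ₖ Kernel.const Unit ν) ()) :=
    integrable_llr _
  have integrable_integral := integrable_comp.integral_comp
  rw [Kernel.const_apply] at integrable_integral
  rw [Measure.comp_eq_comp_const_apply, Kernel.integral_comp integrable_comp, Kernel.const_apply]
  exact integral_mono integrable_integral integrable_klReal fun x =>
    integral_llr_le_klReal ((hac3 x).trans hac2) hac1 (integrable_llr_left x) (integrable_llr _)
end

section
/- For every integer n ≥ 1, the operator 𝒫 has at most one fixed point up to μ-null sets among functions at finite L̄ₙ-distance: if q₁ and q₂ are measurable functions X × Z → ℝ with x' ↦ q₁(x',z) and x' ↦ q₂(x',z) κ(x)-integrable for all x, z, satisfying 𝒫q₁ = q₁ and 𝒫q₂ = q₂ pointwise, and sup_{x ∈ X} ∫ |q₁(x,z) − q₂(x,z)|ⁿ dμ(z) < ∞, then for every x ∈ X, q₁(x,·) = q₂(x,·) μ-almost everywhere on Z. -/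
open MeasureTheory ProbabilityTheory
open scoped ENNReal

/-- Jensen's inequality for powers of `ℝ≥0∞`-valued functions on a probability space. -/
theorem lintegral_pow_le_of_isProbabilityMeasure {Ω : Type*} [MeasurableSpace Ω]
    {P : Measure Ω} [IsProbabilityMeasure P] {n : ℕ} (hn : 1 ≤ n) {f : Ω → ℝ≥0∞}
    (hf : AEMeasurable f P) : (∫⁻ x, f x ∂P) ^ n ≤ ∫⁻ x, f x ^ n ∂P := by
  have hn0 : (n : ℝ) ≠ 0 := by positivity
  have key := eLpNorm'_le_eLpNorm'_of_exponent_le zero_lt_one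
    (by exact_mod_cast hn : (1 : ℝ) ≤ n) P hf.aestronglyMeasurable
  simp only [eLpNorm', enorm_eq_self, ENNReal.rpow_one, one_div, inv_one,
    ENNReal.rpow_natCast] at key
  calc (∫⁻ x, f x ∂P) ^ n ≤ ((∫⁻ x, f x ^ n ∂P) ^ (n : ℝ)⁻¹) ^ n := by gcongr
    _ = ∫⁻ x, f x ^ n ∂P := by
      rw [← ENNReal.rpow_natCast, ENNReal.rpow_inv_rpow hn0]

/-- A function `d` with `d(x,z) = γ ∫ d(x',z) dκ(x)(x')`, `|γ| < 1`, and `sup_x ∫ |d(x,z)|ⁿ dμ(z)`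
finite has vanishing `L̄ₙ`-seminorm. -/
theorem iSup_lintegral_enorm_pow_eq_zero_of_eq_mul_integral
    {X Z : Type*} [MeasurableSpace X] [MeasurableSpace Z]
    {μ : Measure Z} [SFinite μ] {κ : Kernel X X} [IsMarkovKernel κ]
    {γ : ℝ} (hγ : |γ| < 1) {n : ℕ} (hn : 1 ≤ n) {d : X × Z → ℝ} (hd : Measurable d)
    (hfix : ∀ x z, d (x, z) = γ * ∫ x', d (x', z) ∂(κ x))
    (hfin : (⨆ x, ∫⁻ z, ‖d (x, z)‖ₑ ^ n ∂μ) < ⊤) :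
    (⨆ x, ∫⁻ z, ‖d (x, z)‖ₑ ^ n ∂μ) = 0 := by
  set S := ⨆ x, ∫⁻ z, ‖d (x, z)‖ₑ ^ n ∂μ
  have hcontr : S ≤ ‖γ‖ₑ ^ n * S := by
    refine iSup_le fun x => ?_
    calc ∫⁻ z, ‖d (x, z)‖ₑ ^ n ∂μ
        ≤ ∫⁻ z, ‖γ‖ₑ ^ n * ∫⁻ x', ‖d (x', z)‖ₑ ^ n ∂(κ x) ∂μ := by
          refine lintegral_mono fun z => ?_
          rw [hfix x z, enorm_mul, mul_pow]
          gcongr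
          refine (pow_le_pow_left' (enorm_integral_le_lintegral_enorm _) n).trans ?_
          exact lintegral_pow_le_of_isProbabilityMeasure hn (by fun_prop)
      _ = ‖γ‖ₑ ^ n * ∫⁻ x', ∫⁻ z, ‖d (x', z)‖ₑ ^ n ∂μ ∂(κ x) := by
          rw [lintegral_const_mul' _ _ (by finiteness), lintegral_lintegral_swap]
          exact (((hd.comp measurable_swap).enorm).pow_const n).aemeasurable
      _ ≤ ‖γ‖ₑ ^ n * ∫⁻ _, S ∂(κ x) := by
          gcongr with x'
          exact le_iSup (fun x => ∫⁻ z, ‖d (x, z)‖ₑ ^ n ∂μ) x'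
      _ = ‖γ‖ₑ ^ n * S := by simp
  have hγn : ‖γ‖ₑ ^ n < 1 := by
    refine pow_lt_one₀ zero_le ?_ (by omega)
    rwa [Real.enorm_eq_ofReal_abs, ENNReal.ofReal_lt_one]
  by_contra hS
  have := ENNReal.mul_lt_mul_left hS hfin.ne hγn
  rw [one_mul] at this
  exact absurd hcontr this.not_ge

/-- Uniqueness of the fixed point of the operator
`(𝒫q)(x,z) = ∫ ((1−γ)·h(x',z) + γ·q(x',z)) dκ(x)(x')` up to `μ`-null sets, among
functions at finite `L̄ₙ`-distance: if `𝒫q₁ = q₁` and `𝒫q₂ = q₂` pointwise and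
`sup_x ∫ |q₁(x,z) − q₂(x,z)|ⁿ dμ(z) < ∞`, then for every `x`, `q₁(x,·) = q₂(x,·)`
`μ`-almost everywhere. -/
theorem operator_P_fixed_point_unique
    {X Z : Type*} [MeasurableSpace X] [MeasurableSpace Z]
    (μ : Measure Z) [SigmaFinite μ]
    (κ : Kernel X X) [IsMarkovKernel κ]
    (γ : ℝ) (hγ0 : 0 ≤ γ) (hγ1 : γ < 1)
    (h : X × Z → ℝ) (hhmeas : Measurable h) (hhbdd : ∃ C : ℝ, ∀ p, |h p| ≤ C)
    (n : ℕ) (hn : 1 ≤ n)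
    (q₁ q₂ : X × Z → ℝ) (hq₁meas : Measurable q₁) (hq₂meas : Measurable q₂)
    (hq₁int : ∀ x z, Integrable (fun x' => q₁ (x', z)) (κ x))
    (hq₂int : ∀ x z, Integrable (fun x' => q₂ (x', z)) (κ x))
    (hfp₁ : ∀ x z, (∫ x', ((1 - γ) * h (x', z) + γ * q₁ (x', z)) ∂(κ x)) = q₁ (x, z))
    (hfp₂ : ∀ x z, (∫ x', ((1 - γ) * h (x', z) + γ * q₂ (x', z)) ∂(κ x)) = q₂ (x, z))
    (hfin : (⨆ x : X, ∫⁻ z, ENNReal.ofReal (|q₁ (x, z) - q₂ (x, z)| ^ n) ∂μ) < ⊤) :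
    ∀ x : X, (fun z => q₁ (x, z)) =ᵐ[μ] fun z => q₂ (x, z) := by
  have hbridge : ∀ t : ℝ, ENNReal.ofReal (|t| ^ n) = ‖t‖ₑ ^ n := fun t => by
    rw [ENNReal.ofReal_pow (abs_nonneg t), Real.enorm_eq_ofReal_abs]
  simp only [hbridge] at hfin
  have hhint : ∀ x z, Integrable (fun x' => (1 - γ) * h (x', z)) (κ x) := fun x z => by
    obtain ⟨C, hC⟩ := hhbdd
    exact (Integrable.of_bound
      (hhmeas.comp measurable_prodMk_right).aestronglyMeasurable C
      (.of_forall fun x' => hC (x', z))).const_mul _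
  have hfix : ∀ x z, q₁ (x, z) - q₂ (x, z) =
      γ * ∫ x', (q₁ (x', z) - q₂ (x', z)) ∂(κ x) := fun x z => by
    conv_lhs => rw [← hfp₁ x z, ← hfp₂ x z]
    rw [integral_add (hhint x z) ((hq₁int x z).const_mul γ),
      integral_add (hhint x z) ((hq₂int x z).const_mul γ), integral_const_mul γ,
      integral_const_mul γ, integral_sub (hq₁int x z) (hq₂int x z)]
    ring
  have hzero := iSup_lintegral_enorm_pow_eq_zero_of_eq_mul_integral
    (d := fun p => q₁ p - q₂ p) (abs_lt.2 ⟨by linarith, hγ1⟩) hn (by fun_prop) hfix hfin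
  intro x
  have hx := ENNReal.iSup_eq_zero.1 hzero x
  rw [lintegral_eq_zero_iff (by fun_prop)] at hx
  filter_upwards [hx] with z hz
  exact sub_eq_zero.1 (enorm_eq_zero.1 (pow_eq_zero_iff (by omega) |>.1 hz))
end
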